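/- (Γ-limsup inequality) Let d ≥ 2, s ≥ 1, and let {r_n} ⊂ (0,+∞) with r_n → 0⁺. For every measurable set E ⊆ ℝ^d of finite Lebesgue measure there exists a sequence {E_n} of measurable sets of finite Lebesgue measure such that χ_{E_n} → χ_E strongly in L¹(ℝ^d) and lim_{n→∞} J̃_{r_n}^s(E_n)/σ^s(r_n) = ω_{d−1}·Per(E). -/

import Mathlib

open MeasureTheory Filter Set Metric
open scoped ENNReal NNReal symmDiff

noncomputable section

abbrev Euc (d : ℕ) : Type := EuclideanSpace ℝ (Fin d)

/-- The kernel `k^s_r`. -/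
def ker (d : ℕ) (s r t : ℝ) : ℝ :=
  if t ≤ r then r ^ (-((d : ℝ) + s)) else t ^ (-((d : ℝ) + s))

/-- The regularized `s`-fractional perimeter `J̃_r^s(E) = ∫_E ∫_{Eᶜ} k^s_r(|x-y|) dy dx`. -/
def Jt (d : ℕ) (s r : ℝ) (E : Set (Euc d)) : ℝ≥0∞ :=
  ∫⁻ x in E, ∫⁻ y in Eᶜ, ENNReal.ofReal (ker d s r (dist x y))

/-- The scaling factor `σ^s(r)`. -/
def sgm (d : ℕ) (s r : ℝ) : ℝ :=
  if s = 1 then |Real.log r| else (((d : ℝ) + s) / ((d : ℝ) + 1)) * r ^ (1 - s) / (s - 1)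

/-- The scaling factor `β(r,s)` for the simultaneous limit. -/
def betaScale (d : ℕ) (s r : ℝ) : ℝ :=
  (((d : ℝ) + s) / ((d : ℝ) + 1)) * ((r ^ (1 - s) - 1) / (s - 1)) + 1 / ((d : ℝ) + 1)

/-- `ω_k`: Lebesgue measure of the unit ball in `ℝ^k`. -/
def omegaB (k : ℕ) : ℝ := (volume (ball (0 : Euc k) 1)).toReal

/-- Divergence of a vector field on `ℝ^d`. -/
def diverg {d : ℕ} (Φ : Euc d → Euc d) (x : Euc d) : ℝ :=
  ∑ i : Fin d, fderiv ℝ Φ x (EuclideanSpace.single i 1) i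

/-- De Giorgi perimeter. -/
def Per (d : ℕ) (E : Set (Euc d)) : ℝ≥0∞ :=
  ⨆ (Φ : Euc d → Euc d) (_ : ContDiff ℝ 1 Φ) (_ : HasCompactSupport Φ)
    (_ : ∀ x, ‖Φ x‖ ≤ 1), ENNReal.ofReal (∫ x in E, diverg Φ x)

/-- The cube `lQ + ξ` where `Q = [-1/2, 1/2)^d`. -/
def cube (d : ℕ) (l : ℝ) (ξ : Euc d) : Set (Euc d) :=
  {x | ∀ i, x i ∈ Set.Ico (ξ i - l / 2) (ξ i + l / 2)}

/-- Half space `H⁻_ν(0)`. -/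
def Hminus (d : ℕ) (ν : Euc d) : Set (Euc d) := {y | @inner ℝ _ _ ν y ≤ 0}

/-- Standard (normalized) `k`-dimensional Hausdorff measure on `ℝ^d`:
Mathlib's `μH[k]` uses `diam^k` gauges without the normalizing constant `ω_k/2^k`. -/
def Hstd (d : ℕ) (k : ℕ) : Measure (Euc d) :=
  (ENNReal.ofReal (omegaB k / 2 ^ k)) • (μH[(k : ℝ)] : Measure (Euc d))

/-- The nonlocal `k^s_r`-curvature. -/
def curv (d : ℕ) (s r : ℝ) (E : Set (Euc d)) (x : Euc d) : ℝ :=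
  ∫ y, (Set.indicator Eᶜ (fun _ => (1 : ℝ)) y - Set.indicator E (fun _ => (1 : ℝ)) y)
    * ker d s r (dist x y)

/-- The class `𝔈`: closures of open sets with compact `C²` boundary. -/
def IsC2Domain (d : ℕ) (E : Set (Euc d)) : Prop :=
  ∃ U : Set (Euc d), IsOpen U ∧ E = closure U ∧ IsCompact (frontier U) ∧
    ∃ f : Euc d → ℝ, ContDiff ℝ 2 f ∧ U = {x | f x < 0} ∧ frontier U = {x | f x = 0} ∧
      ∀ x ∈ frontier U, fderiv ℝ f x ≠ 0


lemma polar {d : ℕ} (hd : 1 ≤ d) (f : Euc d → ℝ≥0∞) (hf : Measurable f) :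
    ∫⁻ x, f x = ∫⁻ t in Ioi (0:ℝ), ENNReal.ofReal (t ^ (d-1)) *
      ∫⁻ θ : sphere (0 : Euc d) 1, f (t • (θ : Euc d)) ∂(volume : Measure (Euc d)).toSphere := by
  have : Nonempty (Fin d) := ⟨⟨0, hd⟩⟩
  have hm : Measurable (fun p : sphere (0 : Euc d) 1 × Ioi (0:ℝ) => f ((p.2 : ℝ) • (p.1 : Euc d))) := by
    fun_prop
  have hmp := (volume : Measure (Euc d)).measurePreserving_homeomorphUnitSphereProd
  have h1 := hmp.lintegral_comp_emb (Homeomorph.measurableEmbedding _)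
    (fun p : sphere (0 : Euc d) 1 × Ioi (0:ℝ) => f ((p.2 : ℝ) • (p.1 : Euc d)))
  have h2 : ∀ a : ({0}ᶜ : Set (Euc d)), f (((homeomorphUnitSphereProd (Euc d) a).2 : ℝ) •
      ((homeomorphUnitSphereProd (Euc d) a).1 : Euc d)) = f a := by
    intro a
    congr 1
    have ha : ‖(a : Euc d)‖ ≠ 0 := norm_ne_zero_iff.2 a.2
    simp [smul_smul, ha]
  simp_rw [h2] at h1
  rw [lintegral_subtype_comap (measurableSet_singleton _).compl, restrict_compl_singleton] at h1
  rw [h1, lintegral_prod_symm _ hm.aemeasurable, Measure.volumeIoiPow,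
    lintegral_withDensity_eq_lintegral_mul _ (by fun_prop) hm.lintegral_prod_left']
  simp only [Pi.mul_apply, finrank_euclideanSpace, Fintype.card_fin]
  rw [lintegral_subtype_comap measurableSet_Ioi (fun t : ℝ => ENNReal.ofReal (t ^ (d-1)) *
      ∫⁻ θ : sphere (0 : Euc d) 1, f (t • (θ : Euc d)) ∂(volume : Measure (Euc d)).toSphere)]

lemma gauss1 : ∫⁻ x : ℝ, ENNReal.ofReal (|x| * Real.exp (-x^2)) = 1 := by
  have hi : ∫ x in Ioi (0:ℝ), x * Real.exp (-x^2) = 1/2 := by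
    have := integral_rpow_mul_exp_neg_rpow (p := 2) (q := 1) (by norm_num) (by norm_num)
    norm_num at this
    simpa using this
  have hint : Integrable (fun x : ℝ => |x| * Real.exp (-x^2)) := by
    have := (integrable_mul_exp_neg_mul_sq (b := 1) one_pos).norm
    refine this.congr (Eventually.of_forall fun x => ?_)
    simp
  rw [← ofReal_integral_eq_lintegral_ofReal hint (Eventually.of_forall fun x => by positivity)]
  have := integral_comp_abs (f := fun x : ℝ => x * Real.exp (-x^2))
  simp only [sq_abs] at this
  rw [this, hi]; norm_num

lemma gaussd {n : ℕ} :
    ∫⁻ x : Euc (n+1), ENNReal.ofReal (|x 0| * Real.exp (-‖x‖^2)) = ENNReal.ofReal (√Real.pi ^ n) := by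
  let F : Fin (n+1) → ℝ → ℝ := fun i x => (if i = 0 then |x| else 1) * Real.exp (-x^2)
  have hint : ∀ i, Integrable (F i) := by
    intro i
    by_cases h : i = 0
    · simp only [F, h, if_true]
      have := (integrable_mul_exp_neg_mul_sq (b := 1) one_pos).norm
      refine this.congr (Eventually.of_forall fun x => ?_)
      simp
    · simp only [F, h, if_false, one_mul]
      simpa using integrable_exp_neg_mul_sq (b := 1) one_pos
  have hF : ∀ x : Euc (n+1), |x 0| * Real.exp (-‖x‖^2) = ∏ i, F i (x i) := by
    intro x
    simp only [F, Finset.prod_mul_distrib, Finset.prod_ite_eq', Finset.mem_univ, if_true,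
      ← Real.exp_sum]
    rw [EuclideanSpace.norm_sq_eq]
    simp
  simp_rw [hF]
  rw [(PiLp.volume_preserving_ofLp (Fin (n+1))).lintegral_comp_emb
    (MeasurableEquiv.toLp 2 (Fin (n+1) → ℝ)).symm.measurableEmbedding
    (fun y : Fin (n+1) → ℝ => ENNReal.ofReal (∏ i, F i (y i)))]
  have hnn : ∀ i x, 0 ≤ F i x := by
    intro i x; simp only [F]; split_ifs <;> positivity
  rw [← ofReal_integral_eq_lintegral_ofReal (μ := volume) (Integrable.fintype_prod hint)
    (Eventually.of_forall fun x => Finset.prod_nonneg fun i _ => hnn i _),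
    integral_fintype_prod_volume_eq_prod, Fin.prod_univ_succ]
  have h0 : ∫ x, F 0 x = 1 := by
    have := gauss1
    rw [← ofReal_integral_eq_lintegral_ofReal (by simpa [F] using hint 0)
      (Eventually.of_forall fun x => by positivity)] at this
    simpa [F] using this
  have h1 : ∀ i : Fin n, ∫ x, F i.succ x = √Real.pi := by
    intro i
    have := integral_gaussian 1
    simpa [F, Fin.succ_ne_zero] using this
  simp [h0, h1]

lemma omegaB_eq (n : ℕ) : omegaB n = √Real.pi ^ n / Real.Gamma (n / 2 + 1) := by
  rcases Nat.eq_zero_or_pos n with rfl | hn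
  · simp [omegaB, volume_euclideanSpace_eq_dirac]
  · have : Nonempty (Fin n) := ⟨⟨0, hn⟩⟩
    rw [omegaB, EuclideanSpace.volume_ball]
    simp only [ENNReal.ofReal_one, one_pow, Fintype.card_fin, one_mul]
    rw [ENNReal.toReal_ofReal]
    have := Real.Gamma_pos_of_pos (s := (n:ℝ)/2+1) (by positivity)
    positivity

lemma omegaB_pos (n : ℕ) : 0 < omegaB n := by
  rw [omegaB_eq]
  have := Real.Gamma_pos_of_pos (s := (n:ℝ)/2+1) (by positivity)
  positivity

lemma gaussv {n : ℕ} (v : Euc (n+1)) :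
    ∫⁻ x : Euc (n+1), ENNReal.ofReal (|@inner ℝ _ _ v x| * Real.exp (-‖x‖^2)) =
      ENNReal.ofReal (‖v‖ * √Real.pi ^ n) := by
  by_cases hv : v = 0
  · simp [hv]
  have hv' : ‖v‖ ≠ 0 := by simpa using hv
  obtain ⟨b, hb⟩ := Orthonormal.exists_orthonormalBasis_extension_of_card_eq (𝕜 := ℝ) (E := Euc (n+1))
    (ι := Fin (n+1)) (by simp) (v := fun _ => ‖v‖⁻¹ • v) (s := {0}) (by
      constructor
      · intro i; simp [norm_smul, hv']
      · intro i j hij; exact absurd (Subsingleton.elim i j) hij)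
  have hb0 := hb 0 rfl
  have key : ∀ x : Euc (n+1), |@inner ℝ _ _ v x| * Real.exp (-‖x‖^2) =
      ‖v‖ * (|(b.repr x) 0| * Real.exp (-‖b.repr x‖^2)) := by
    intro x
    rw [b.repr_apply_apply, hb0, LinearIsometryEquiv.norm_map, real_inner_smul_left, abs_mul,
      abs_inv, abs_norm]
    field_simp
  simp_rw [key]
  rw [b.measurePreserving_repr.lintegral_comp_emb b.repr.toHomeomorph.measurableEmbedding
    (fun y => ENNReal.ofReal (‖v‖ * (|y 0| * Real.exp (-‖y‖^2))))]
  simp_rw [ENNReal.ofReal_mul (norm_nonneg v)]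
  rw [lintegral_const_mul _ (by fun_prop), gaussd]

lemma sphere_const {n : ℕ} (v : Euc (n+1)) :
    ∫⁻ θ : sphere (0 : Euc (n+1)) 1, ‖@inner ℝ _ _ v (θ : Euc (n+1))‖ₑ
      ∂(volume : Measure (Euc (n+1))).toSphere = 2 * ENNReal.ofReal (omegaB n) * ‖v‖ₑ := by
  have h := gaussv v
  rw [polar (by omega) _ (by fun_prop)] at h
  have h2 : ∀ t ∈ Ioi (0:ℝ), ENNReal.ofReal (t ^ (n + 1 - 1)) *
      ∫⁻ θ : sphere (0 : Euc (n+1)) 1, ENNReal.ofReal (|@inner ℝ _ _ v (t • (θ : Euc (n+1)))| *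
        Real.exp (-‖t • (θ : Euc (n+1))‖^2)) ∂(volume : Measure (Euc (n+1))).toSphere
      = ENNReal.ofReal (t ^ ((n+1 : ℕ):ℝ) * Real.exp (-t ^ (2:ℝ))) *
        ∫⁻ θ : sphere (0 : Euc (n+1)) 1, ‖@inner ℝ _ _ v (θ : Euc (n+1))‖ₑ
      ∂(volume : Measure (Euc (n+1))).toSphere := by
    intro t ht
    have ht : 0 < t := ht
    rw [← lintegral_const_mul _ (by fun_prop), ← lintegral_const_mul _ (by fun_prop)]
    congr 1 with θ
    rw [← ofReal_norm, ← ENNReal.ofReal_mul (by positivity),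
      ← ENNReal.ofReal_mul (by positivity)]
    congr 1
    have : ‖(θ : Euc (n+1))‖ = 1 := by simp
    rw [inner_smul_right, norm_smul, this, Real.norm_eq_abs, Real.norm_eq_abs, abs_mul, abs_of_pos ht,
      Real.rpow_natCast]
    norm_num
    ring
  rw [setLIntegral_congr_fun measurableSet_Ioi h2, lintegral_mul_const _ (by fun_prop)] at h
  have hG := integral_rpow_mul_exp_neg_rpow (p := 2) (q := ((n+1:ℕ):ℝ)) (by norm_num)
    (by have : (0:ℝ) ≤ ((n+1:ℕ):ℝ) := by positivity
        linarith)
  have hGp : 0 < Real.Gamma ((n:ℝ)/2+1) := Real.Gamma_pos_of_pos (by positivity)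
  have e : (((n+1:ℕ):ℝ) + 1)/2 = (n:ℝ)/2+1 := by push_cast; ring
  rw [e] at hG
  rw [← ofReal_integral_eq_lintegral_ofReal (by
      by_contra hni
      rw [integral_undef hni] at hG
      have : 0 < 1 / 2 * Real.Gamma ((n:ℝ)/2+1) := by positivity
      linarith)
    ((ae_restrict_iff' measurableSet_Ioi).2 (Eventually.of_forall fun x hx => by
      have hx : 0 < x := hx
      simp only [Pi.zero_apply]
      positivity)), hG] at h
  have hne : ENNReal.ofReal (1 / 2 * Real.Gamma ((n:ℝ)/2+1)) ≠ 0 := by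
    simp only [ne_eq, ENNReal.ofReal_eq_zero, not_le]; positivity
  rw [← ENNReal.mul_right_inj hne ENNReal.ofReal_ne_top, h, omegaB_eq, ← ofReal_norm]
  have h22 : ∀ x : ℝ, (2:ℝ≥0∞) * ENNReal.ofReal x = ENNReal.ofReal (2 * x) := by
    intro x; rw [ENNReal.ofReal_mul (by norm_num)]; simp
  rw [h22, ← ENNReal.ofReal_mul (by positivity),
    ← ENNReal.ofReal_mul (by positivity)]
  congr 1
  field_simp

def KK (d : ℕ) (s r δ : ℝ) : ℝ≥0∞ :=
  ∫⁻ t in Ioc (0:ℝ) δ, ENNReal.ofReal (t ^ (d-1)) * (ENNReal.ofReal (ker d s r t) * ENNReal.ofReal t)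

def KR (d : ℕ) (s r δ : ℝ) : ℝ :=
  r ^ (1-s) / (d+1) + (if s = 1 then Real.log (δ / r) else (r ^ (1-s) - δ ^ (1-s)) / (s-1))

lemma lint_Ioc (a b : ℝ) (hab : a ≤ b) (f : ℝ → ℝ) (hf : IntervalIntegrable f volume a b)
    (h0 : ∀ t ∈ Ioc a b, 0 ≤ f t) :
    ∫⁻ t in Ioc a b, ENNReal.ofReal (f t) = ENNReal.ofReal (∫ t in a..b, f t) := by
  rw [intervalIntegral.integral_of_le hab, ofReal_integral_eq_lintegral_ofReal]
  · exact (intervalIntegrable_iff_integrableOn_Ioc_of_le hab).1 hf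
  · exact (ae_restrict_iff' measurableSet_Ioc).2 (Eventually.of_forall h0)

lemma KK_eq (d : ℕ) (hd : 1 ≤ d) (s r δ : ℝ) (hs : 1 ≤ s) (hr : 0 < r) (hδ : r < δ) :
    KK d s r δ = ENNReal.ofReal (KR d s r δ) := by
  have hδ0 : 0 < δ := hr.trans hδ
  rw [KK, ← Ioc_union_Ioc_eq_Ioc hr.le hδ.le, lintegral_union measurableSet_Ioc
    (Set.disjoint_left.2 fun x hx hx' => absurd hx.2 (not_le.2 hx'.1))]
  have e1 : ∀ t ∈ Ioc (0:ℝ) r, ENNReal.ofReal (t ^ (d-1)) *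
      (ENNReal.ofReal (ker d s r t) * ENNReal.ofReal t) =
      ENNReal.ofReal (r ^ (-((d:ℝ)+s)) * t ^ d) := by
    intro t ht
    have ht0 : 0 < t := ht.1
    have : t ^ d = t ^ (d-1) * t := by rw [← pow_succ]; congr 1; omega
    rw [_root_.ker, if_pos ht.2, ← ENNReal.ofReal_mul (by positivity), ← ENNReal.ofReal_mul (by positivity), this]
    congr 1; ring
  have e2 : ∀ t ∈ Ioc r δ, ENNReal.ofReal (t ^ (d-1)) *
      (ENNReal.ofReal (ker d s r t) * ENNReal.ofReal t) =
      ENNReal.ofReal (t ^ (-s)) := by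
    intro t ht
    have ht0 : 0 < t := hr.trans ht.1
    have h1 : t ^ d = t ^ (d-1) * t := by rw [← pow_succ]; congr 1; omega
    rw [_root_.ker, if_neg (not_le.2 ht.1), ← ENNReal.ofReal_mul (by positivity), ← ENNReal.ofReal_mul (by positivity)]
    congr 1
    rw [show t ^ (d-1) * (t ^ (-((d:ℝ)+s)) * t) = t ^ (-((d:ℝ)+s)) * t ^ d by rw [h1]; ring,
      ← Real.rpow_natCast t d, ← Real.rpow_add ht0]
    congr 1; ring
  rw [setLIntegral_congr_fun measurableSet_Ioc e1, setLIntegral_congr_fun measurableSet_Ioc e2,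
    lint_Ioc _ _ hr.le _ (by apply Continuous.intervalIntegrable; fun_prop)
      (fun t ht => by have := ht.1; positivity),
    lint_Ioc _ _ hδ.le _ (by
      apply intervalIntegral.intervalIntegrable_rpow
      right
      rw [Set.uIcc_of_le hδ.le]
      intro h; exact absurd h.1 (not_le.2 hr)) (fun t ht => by
        have := hr.trans ht.1; positivity), ← ENNReal.ofReal_add]
  · congr 1
    rw [KR, intervalIntegral.integral_const_mul, integral_pow]
    congr 1
    · rw [zero_pow (by omega), sub_zero, mul_div_assoc']
      congr 1
      rw [← Real.rpow_natCast r (d+1), ← Real.rpow_add hr]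
      congr 1; push_cast; ring
    · split_ifs with h
      · subst h
        simp_rw [Real.rpow_neg_one]
        rw [integral_inv_of_pos hr hδ0]
      · rw [integral_rpow (by
          right
          refine ⟨fun h' => h (by linarith), ?_⟩
          rw [Set.uIcc_of_le hδ.le]
          intro h; exact absurd h.1 (not_le.2 hr))]
        have h1 : s - 1 ≠ 0 := fun h' => h (by linarith)
        have h2 : -s + 1 ≠ 0 := fun h' => h (by linarith)
        rw [show -s + 1 = 1 - s by ring] at *
        rw [show s - 1 = -(1 - s) by ring, div_neg, ← neg_div]
        congr 1; ring
  · apply intervalIntegral.integral_nonneg hr.le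
    intro t ht; have := ht.1; positivity
  · apply intervalIntegral.integral_nonneg hδ.le
    intro t ht; have := hr.trans_le ht.1; positivity

lemma rpow_tendsto_top (a : ℝ) (ha : a < 0) (r : ℕ → ℝ) (hr : ∀ n, 0 < r n)
    (hr0 : Tendsto r atTop (nhds 0)) : Tendsto (fun n => r n ^ a) atTop atTop := by
  have h1 : Tendsto r atTop (nhdsWithin 0 (Ioi 0)) :=
    tendsto_nhdsWithin_iff.2 ⟨hr0, Eventually.of_forall hr⟩
  exact (tendsto_rpow_neg_nhdsGT_zero ha).comp h1

lemma neglog_tendsto_top (r : ℕ → ℝ) (hr : ∀ n, 0 < r n)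
    (hr0 : Tendsto r atTop (nhds 0)) : Tendsto (fun n => - Real.log (r n)) atTop atTop := by
  have h1 : Tendsto r atTop (nhdsWithin 0 (Ioi 0)) :=
    tendsto_nhdsWithin_iff.2 ⟨hr0, Eventually.of_forall hr⟩
  exact tendsto_neg_atBot_atTop.comp (Real.tendsto_log_nhdsGT_zero.comp h1)

lemma sgm_tendsto (d : ℕ) (s : ℝ) (hs : 1 ≤ s) (r : ℕ → ℝ) (hr : ∀ n, 0 < r n)
    (hr0 : Tendsto r atTop (nhds 0)) : Tendsto (fun n => sgm d s (r n)) atTop atTop := by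
  by_cases h : s = 1
  · simp only [sgm, h, if_true]
    exact tendsto_atTop_mono (fun n => neg_le_abs _) (neglog_tendsto_top r hr hr0)
  · simp only [sgm, h, if_false]
    have hs1 : 0 < s - 1 := by
      have := lt_of_le_of_ne hs (Ne.symm h); linarith
    apply Tendsto.atTop_div_const hs1
    apply Tendsto.const_mul_atTop (by positivity)
    exact rpow_tendsto_top _ (by linarith) r hr hr0

lemma KR_tendsto (d : ℕ) (s δ : ℝ) (hs : 1 ≤ s) (hδ : 0 < δ) (r : ℕ → ℝ) (hr : ∀ n, 0 < r n)
    (hr0 : Tendsto r atTop (nhds 0)) :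
    Tendsto (fun n => KR d s (r n) δ / sgm d s (r n)) atTop (nhds 1) := by
  by_cases h : s = 1
  · have hl := neglog_tendsto_top r hr hr0
    have h1 : Tendsto (fun n => (1/((d:ℝ)+1) + Real.log δ) / (- Real.log (r n)) + 1) atTop (nhds (0+1)) :=
      (Tendsto.const_div_atTop hl _).add tendsto_const_nhds
    rw [zero_add] at h1
    refine h1.congr' ?_
    filter_upwards [hl.eventually_gt_atTop 0] with n hn
    simp only [KR, sgm, h, if_true, sub_self, Real.rpow_zero]
    rw [Real.log_div hδ.ne' (hr n).ne', abs_of_neg (by linarith)]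
    have : Real.log (r n) ≠ 0 := by intro h; rw [h] at hn; simp at hn
    field_simp
    ring
  · have hs1 : 0 < s - 1 := by
      have := lt_of_le_of_ne hs (Ne.symm h); linarith
    have hl := rpow_tendsto_top (1-s) (by linarith) r hr hr0
    have h1 : Tendsto (fun n => 1 - (δ ^ (1-s) * ((d:ℝ)+1) / (d+s)) / (r n ^ (1-s))) atTop (nhds (1-0)) :=
      tendsto_const_nhds.sub (Tendsto.const_div_atTop hl _)
    rw [sub_zero] at h1
    refine h1.congr fun n => ?_
    simp only [KR, sgm, h, if_false]
    have hp : 0 < r n ^ (1-s) := Real.rpow_pos_of_pos (hr n) _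
    have hds : 0 < (d:ℝ) + s := by positivity
    generalize r n ^ (1-s) = A at *
    generalize δ ^ (1-s) = B at *
    field_simp
    ring

lemma KK_tendsto (d : ℕ) (hd : 1 ≤ d) (s δ : ℝ) (hs : 1 ≤ s) (hδ : 0 < δ) (r : ℕ → ℝ) (hr : ∀ n, 0 < r n)
    (hr0 : Tendsto r atTop (nhds 0)) :
    Tendsto (fun n => KK d s (r n) δ / ENNReal.ofReal (sgm d s (r n))) atTop (nhds 1) := by
  have h := ENNReal.tendsto_ofReal (KR_tendsto d s δ hs hδ r hr hr0)
  rw [ENNReal.ofReal_one] at h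
  refine h.congr' ?_
  filter_upwards [hr0.eventually_lt_const hδ, (sgm_tendsto d s hs r hr hr0).eventually_gt_atTop 0] with n h1 h2
  rw [KK_eq d hd s _ δ hs (hr n) h1, ENNReal.ofReal_div_of_pos h2]

lemma tail_bound (d : ℕ) (hd : 1 ≤ d) (s : ℝ) (hs : 1 ≤ s) : ∃ C : ℝ≥0∞, C ≠ ⊤ ∧ ∀ r : ℝ, 0 < r → r < 1 →
    ∫⁻ t in Ioi (1:ℝ), ENNReal.ofReal (t ^ (d-1)) * ENNReal.ofReal (ker d s r t) ≤ C := by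
  refine ⟨∫⁻ t in Ioi (1:ℝ), ENNReal.ofReal (t ^ (-s-1)), ?_, ?_⟩
  · exact (integrableOn_Ioi_rpow_of_lt (by linarith) one_pos).lintegral_lt_top.ne
  · intro r hr hr1
    apply le_of_eq
    apply setLIntegral_congr_fun measurableSet_Ioi
    intro t ht
    have ht1 : 1 < t := ht
    have ht0 : 0 < t := by linarith
    simp only
    rw [_root_.ker, if_neg (by linarith), ← ENNReal.ofReal_mul (by positivity), ← Real.rpow_natCast, ← Real.rpow_add ht0]
    congr 2
    push_cast [hd]; ring

def FF {d : ℕ} (u : Euc d → ℝ) (h : Euc d) : ℝ≥0∞ := ∫⁻ x, ‖u (x + h) - u x‖ₑ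

def GG {d : ℕ} (u : Euc d → ℝ) (t : ℝ) : ℝ≥0∞ :=
  ∫⁻ θ : sphere (0 : Euc d) 1, FF u (t • (θ : Euc d)) ∂(volume : Measure (Euc d)).toSphere

lemma FF_meas {d : ℕ} (u : Euc d → ℝ) (hu : Measurable u) : Measurable (FF u) := by
  unfold FF
  exact Measurable.lintegral_prod_right' (f := fun p : Euc d × Euc d => ‖u (p.2 + p.1) - u p.2‖ₑ)
    (by fun_prop)

lemma sphere_const' {n : ℕ} (L : Euc (n+1) →L[ℝ] ℝ) :
    ∫⁻ θ : sphere (0 : Euc (n+1)) 1, ‖L (θ : Euc (n+1))‖ₑ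
      ∂(volume : Measure (Euc (n+1))).toSphere = 2 * ENNReal.ofReal (omegaB n) * ‖L‖ₑ := by
  have h := sphere_const ((InnerProductSpace.toDual ℝ (Euc (n+1))).symm L)
  simp only [InnerProductSpace.toDual_symm_apply] at h
  rw [h, ← ofReal_norm, ← ofReal_norm, LinearIsometryEquiv.norm_map]

lemma FF_le {d : ℕ} (f : Euc d → ℝ) (hf : ContDiff ℝ 1 f) (h : Euc d) :
    FF f h ≤ ∫⁻ x, ‖fderiv ℝ f x h‖ₑ := by
  have hc : Continuous (fderiv ℝ f) := hf.continuous_fderiv one_ne_zero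
  have h1 : ∀ x, ‖f (x + h) - f x‖ₑ ≤ ∫⁻ τ in Ioc (0:ℝ) 1, ‖fderiv ℝ f (x + τ • h) h‖ₑ := by
    intro x
    have hd : ∀ τ ∈ uIcc (0:ℝ) 1, HasDerivAt (fun τ : ℝ => f (x + τ • h)) (fderiv ℝ f (x + τ • h) h) τ := by
      intro τ _
      have h2 : HasDerivAt (fun τ : ℝ => x + τ • h) h τ := by
        simpa using ((hasDerivAt_id τ).smul_const h).const_add x
      exact ((hf.differentiable one_ne_zero _).hasFDerivAt).comp_hasDerivAt τ h2
    have h3 := intervalIntegral.integral_eq_sub_of_hasDerivAt hd (by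
      apply Continuous.intervalIntegrable; fun_prop)
    simp only [one_smul, zero_smul, add_zero] at h3
    rw [← h3, intervalIntegral.integral_of_le zero_le_one]
    exact enorm_integral_le_lintegral_enorm _
  calc FF f h ≤ ∫⁻ x, ∫⁻ τ in Ioc (0:ℝ) 1, ‖fderiv ℝ f (x + τ • h) h‖ₑ := lintegral_mono h1
    _ = ∫⁻ τ in Ioc (0:ℝ) 1, ∫⁻ x, ‖fderiv ℝ f (x + τ • h) h‖ₑ := by
        apply lintegral_lintegral_swap
        apply Measurable.aemeasurable
        apply Continuous.measurable
        simp only [Function.uncurry_def]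
        fun_prop
    _ = ∫⁻ τ in Ioc (0:ℝ) 1, ∫⁻ x, ‖fderiv ℝ f x h‖ₑ := by
        congr 1 with τ
        exact lintegral_add_right_eq_self (fun x => ‖fderiv ℝ f x h‖ₑ) (τ • h)
    _ = _ := by simp

lemma swap_sphere {n : ℕ} (f : Euc (n+1) → ℝ) (hf : ContDiff ℝ 1 f) :
    ∫⁻ θ : sphere (0 : Euc (n+1)) 1, (∫⁻ x, ‖fderiv ℝ f x (θ : Euc (n+1))‖ₑ)
      ∂(volume : Measure (Euc (n+1))).toSphere
      = 2 * ENNReal.ofReal (omegaB n) * ∫⁻ x, ‖fderiv ℝ f x‖ₑ := by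
  have hc : Continuous (fderiv ℝ f) := hf.continuous_fderiv one_ne_zero
  rw [lintegral_lintegral_swap]
  · simp_rw [sphere_const']
    rw [lintegral_const_mul _ (by fun_prop)]
  · apply Measurable.aemeasurable
    apply Continuous.measurable
    simp only [Function.uncurry_def]
    fun_prop

lemma GG_le {n : ℕ} (f : Euc (n+1) → ℝ) (hf : ContDiff ℝ 1 f) (t : ℝ) :
    GG f t ≤ ‖t‖ₑ * (2 * ENNReal.ofReal (omegaB n) * ∫⁻ x, ‖fderiv ℝ f x‖ₑ) := by
  have hc : Continuous (fderiv ℝ f) := hf.continuous_fderiv one_ne_zero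
  rw [← swap_sphere f hf, GG, ← lintegral_const_mul']
  · apply lintegral_mono
    intro θ
    refine (FF_le f hf _).trans ?_
    simp only [map_smul, smul_eq_mul, enorm_mul]
    rw [lintegral_const_mul _ (by fun_prop)]
  · simp

lemma GG_liminf {n : ℕ} (f : Euc (n+1) → ℝ) (hf : ContDiff ℝ 1 f) :
    2 * ENNReal.ofReal (omegaB n) * ∫⁻ x, ‖fderiv ℝ f x‖ₑ ≤
      liminf (fun t : ℝ => ‖t⁻¹‖ₑ * GG f t) (nhdsWithin 0 (Ioi 0)) := by
  rw [← swap_sphere f hf]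
  have hfc : Continuous f := hf.continuous
  have hpt : ∀ x θ : Euc (n+1), ‖fderiv ℝ f x θ‖ₑ =
      liminf (fun t : ℝ => ‖t⁻¹ • (f (x + t • θ) - f x)‖ₑ) (nhdsWithin 0 (Ioi 0)) := by
    intro x θ
    symm
    apply Tendsto.liminf_eq
    have := ((hf.differentiable one_ne_zero x).hasFDerivAt.hasLineDerivAt θ).tendsto_slope_zero_right
    exact this.enorm
  have hG : ∀ t : ℝ, ‖t⁻¹‖ₑ * GG f t = ∫⁻ θ : sphere (0 : Euc (n+1)) 1,
      (∫⁻ x, ‖t⁻¹ • (f (x + t • (θ : Euc (n+1))) - f x)‖ₑ)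
      ∂(volume : Measure (Euc (n+1))).toSphere := by
    intro t
    rw [GG, ← lintegral_const_mul' _ _ (by simp)]
    congr 1 with θ
    rw [FF, ← lintegral_const_mul' _ _ (by simp)]
    simp [enorm_smul, enorm_mul]
  simp_rw [hG, hpt]
  refine le_trans (lintegral_mono fun θ => lintegral_liminf_le ?_) (lintegral_liminf_le ?_)
  · intro t; fun_prop
  · intro t
    exact Measurable.lintegral_prod_right' (f := fun p : sphere (0 : Euc (n+1)) 1 × Euc (n+1) =>
      ‖t⁻¹ • (f (p.2 + t • (p.1 : Euc (n+1))) - f p.2)‖ₑ) (by fun_prop)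
open scoped Convolution

def mol {d : ℕ} {F : Type*} [NormedAddCommGroup F] [NormedSpace ℝ F] (φ : ContDiffBump (0 : Euc d))
    (g : Euc d → F) : Euc d → F :=
  φ.normed volume ⋆[ContinuousLinearMap.lsmul ℝ ℝ, volume] g

section
variable {d : ℕ} {F : Type*} [NormedAddCommGroup F] [NormedSpace ℝ F]
  (φ : ContDiffBump (0 : Euc d))

lemma eta_contDiff : ContDiff ℝ 1 (φ.normed volume) := φ.contDiff_normed

lemma mol_contDiff (g : Euc d → F) (hg : LocallyIntegrable g) : ContDiff ℝ 1 (mol φ g) :=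
  φ.hasCompactSupport_normed.contDiff_convolution_left _ (eta_contDiff φ) hg

lemma mol_apply (g : Euc d → F) (x : Euc d) :
    mol φ g x = ∫ t, φ.normed volume t • g (x - t) := rfl

lemma mol_fderiv (g : Euc d → F) (hg : LocallyIntegrable g) (x v : Euc d) :
    fderiv ℝ (mol φ g) x v = ∫ y, fderiv ℝ (φ.normed volume) (x - y) v • g y := by
  have h := φ.hasCompactSupport_normed.hasFDerivAt_convolution_left
    (ContinuousLinearMap.lsmul ℝ ℝ) (eta_contDiff φ) hg x
  have hex : ConvolutionExists (fderiv ℝ (φ.normed volume)) g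
      ((ContinuousLinearMap.lsmul ℝ ℝ : ℝ →L[ℝ] F →L[ℝ] F).precompL (Euc d)) volume :=
    (φ.hasCompactSupport_normed.fderiv (𝕜 := ℝ)).convolutionExists_left _
      ((eta_contDiff φ).continuous_fderiv one_ne_zero) hg
  rw [show fderiv ℝ (mol φ g) x = _ from h.fderiv, convolution_def,
    ContinuousLinearMap.integral_apply (hex x)]
  simp only [ContinuousLinearMap.precompL_apply, ContinuousLinearMap.lsmul_apply]
  rw [← integral_sub_left_eq_self (fun t => (fderiv ℝ (φ.normed volume) t) v • g (x - t)) volume x]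
  simp

lemma eta_fderiv_neg (z : Euc d) :
    fderiv ℝ (φ.normed volume) (-z) = - fderiv ℝ (φ.normed volume) z := by
  have h : (fun x => φ.normed volume (-x)) = φ.normed volume := by
    ext x; exact φ.normed_neg x
  have h2 := fderiv_comp_smul (𝕜 := ℝ) (f := φ.normed (volume : Measure (Euc d))) (x := z) (-1)
  simp only [neg_smul, one_smul] at h2
  rw [h] at h2
  rw [h2, neg_neg]

lemma mol_norm_le (g : Euc d → F) (hg : ∀ x, ‖g x‖ ≤ 1) (x : Euc d) : ‖mol φ g x‖ ≤ 1 := by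
  rw [mol_apply, ← φ.integral_normed (μ := volume)]
  apply norm_integral_le_of_norm_le φ.integrable_normed
  refine Eventually.of_forall fun t => ?_
  rw [norm_smul, Real.norm_of_nonneg (φ.nonneg_normed t)]
  exact mul_le_of_le_one_right (φ.nonneg_normed t) (hg _)

lemma FF_mol_le (u : Euc d → ℝ) (hu : Integrable u) (hum : Measurable u) (h : Euc d) :
    FF (mol φ u) h ≤ FF u h := by
  have hex : ∀ x, Integrable (fun t => φ.normed volume t • u (x - t)) := fun x =>
    (φ.hasCompactSupport_normed.convolutionExists_left (ContinuousLinearMap.lsmul ℝ ℝ)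
      φ.continuous_normed hu.locallyIntegrable) x
  have hcm : Measurable (φ.normed (volume : Measure (Euc d))) := φ.continuous_normed.measurable
  have h1 : ∀ x, ‖mol φ u (x + h) - mol φ u x‖ₑ ≤
      ∫⁻ t, ‖φ.normed volume t‖ₑ * ‖u (x - t + h) - u (x - t)‖ₑ := by
    intro x
    rw [mol_apply, mol_apply, ← integral_sub (hex _) (hex _)]
    refine (enorm_integral_le_lintegral_enorm _).trans (le_of_eq ?_)
    congr 1 with t
    rw [← smul_sub, enorm_smul, show x + h - t = x - t + h by abel]
  calc FF (mol φ u) h ≤ ∫⁻ x, ∫⁻ t, ‖φ.normed volume t‖ₑ * ‖u (x - t + h) - u (x - t)‖ₑ :=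
        lintegral_mono h1
    _ = ∫⁻ t, ∫⁻ x, ‖φ.normed volume t‖ₑ * ‖u (x - t + h) - u (x - t)‖ₑ := by
        apply lintegral_lintegral_swap
        apply Measurable.aemeasurable
        simp only [Function.uncurry_def]
        fun_prop
    _ = ∫⁻ t, ‖φ.normed volume t‖ₑ * FF u h := by
        congr 1 with t
        rw [lintegral_const_mul' _ _ (by simp), FF]
        congr 1
        exact lintegral_sub_right_eq_self (fun x => ‖u (x + h) - u x‖ₑ) t
    _ = FF u h := by
        rw [lintegral_mul_const _ (by fun_prop)]
        have : ∫⁻ t, ‖φ.normed (volume : Measure (Euc d)) t‖ₑ = 1 := by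
          have h2 := φ.integral_normed (μ := volume)
          have h3 : ∀ t, ‖φ.normed (volume : Measure (Euc d)) t‖ₑ = ENNReal.ofReal (φ.normed volume t) :=
            fun t => Real.enorm_of_nonneg (φ.nonneg_normed t)
          simp_rw [h3]
          rw [← ofReal_integral_eq_lintegral_ofReal φ.integrable_normed
            (Eventually.of_forall φ.nonneg_normed), h2, ENNReal.ofReal_one]
        rw [this, one_mul]

end

def chi {d : ℕ} (E : Set (Euc d)) : Euc d → ℝ := E.indicator (fun _ => 1)

section

lemma chi_meas {d : ℕ} {E : Set (Euc d)} (hE : MeasurableSet E) : Measurable (chi E) :=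
  measurable_const.indicator hE

lemma chi_int {d : ℕ} {E : Set (Euc d)} (hE : MeasurableSet E) (hEf : volume E < ⊤) :
    Integrable (chi E) := (integrable_indicator_iff hE).2 (integrableOn_const hEf.ne)

lemma chi_norm {d : ℕ} (E : Set (Euc d)) (x : Euc d) : ‖chi E x‖ ≤ 1 := by
  by_cases h : x ∈ E <;> simp [chi, h]

lemma per_ball {d : ℕ} {E : Set (Euc d)} (hE : MeasurableSet E) (hEf : volume E < ⊤)
    (φ : ContDiffBump (0 : Euc d)) (R : ℝ) :
    ∫⁻ x in ball 0 R, ‖fderiv ℝ (mol φ (chi E)) x‖ₑ ≤ Per d E := by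
  set f := mol φ (chi E) with hf
  have hu := chi_int hE hEf
  have hf1 : ContDiff ℝ 1 f := mol_contDiff φ _ hu.locallyIntegrable
  have hfc : Continuous (fderiv ℝ f) := hf1.continuous_fderiv one_ne_zero
  let η := φ.normed (volume : Measure (Euc d))
  have hηc : Continuous (fderiv ℝ η) := (eta_contDiff φ).continuous_fderiv one_ne_zero
  let g : Euc d → Euc d := fun x => (InnerProductSpace.toDual ℝ (Euc d)).symm (fderiv ℝ f x)
  have hgc : Continuous g := (LinearIsometryEquiv.continuous _).comp hfc
  have hgn : ∀ x, ‖g x‖ = ‖fderiv ℝ f x‖ := fun x => LinearIsometryEquiv.norm_map _ _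
  let Φ : Euc d → Euc d := (ball 0 R).indicator (fun x => ‖g x‖⁻¹ • g x)
  have hΦm : Measurable Φ := by
    apply Measurable.indicator _ measurableSet_ball
    exact (hgc.measurable.norm.inv).smul hgc.measurable
  have hΦn : ∀ x, ‖Φ x‖ ≤ 1 := by
    intro x
    by_cases hx : x ∈ ball (0 : Euc d) R
    · simp only [Φ, hx, indicator_of_mem, norm_smul, norm_inv, norm_norm]
      exact inv_mul_le_one
    · simp [Φ, hx]
  have hΦs : HasCompactSupport Φ := by
    apply HasCompactSupport.intro (isCompact_closedBall (0 : Euc d) R)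
    intro x hx
    have : x ∉ ball (0 : Euc d) R := fun h => hx (ball_subset_closedBall h)
    simp [Φ, this]
  have hΦi : Integrable Φ := by
    have h1 : Integrable ((ball (0 : Euc d) R).indicator (fun _ => (1:ℝ))) :=
      (integrable_indicator_iff measurableSet_ball).2 (integrableOn_const measure_ball_lt_top.ne)
    refine h1.mono' hΦm.aestronglyMeasurable (Eventually.of_forall fun x => ?_)
    by_cases hx : x ∈ ball (0 : Euc d) R
    · simpa [hx] using hΦn x
    · simp [Φ, hx]
  have hfΦ : ∀ x, fderiv ℝ f x (Φ x) = (ball 0 R).indicator (fun x => ‖fderiv ℝ f x‖) x := by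
    intro x
    by_cases hx : x ∈ ball (0 : Euc d) R
    · simp only [Φ, hx, indicator_of_mem, map_smul, smul_eq_mul]
      have : fderiv ℝ f x (g x) = ‖g x‖ ^ 2 := by
        rw [← real_inner_self_eq_norm_sq, InnerProductSpace.toDual_symm_apply]
      rw [this, ← hgn]
      by_cases h0 : ‖g x‖ = 0
      · simp [h0]
      · field_simp
    · simp [Φ, hx]
  let ψ := mol φ Φ
  have hψ1 : ContDiff ℝ 1 ψ := mol_contDiff φ _ hΦi.locallyIntegrable
  have hψs : HasCompactSupport ψ := φ.hasCompactSupport_normed.convolution _ hΦs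
  have hψn : ∀ x, ‖ψ x‖ ≤ 1 := mol_norm_le φ Φ hΦn
  obtain ⟨C, hC⟩ : ∃ C, ∀ z, ‖fderiv ℝ η z‖ ≤ C :=
    (φ.hasCompactSupport_normed.fderiv (𝕜 := ℝ)).exists_bound_of_continuous hηc
  have hint1 : ∀ y v, Integrable (fun x => fderiv ℝ η (y - x) v • Φ x) := by
    intro y v
    have hcc : Continuous (fun x => fderiv ℝ η (y - x) v) :=
      (hηc.comp (continuous_const.sub continuous_id)).clm_apply continuous_const
    refine hΦi.bdd_smul (φ := fun x => fderiv ℝ η (y - x) v) (C * ‖v‖)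
      hcc.aestronglyMeasurable (Eventually.of_forall fun x => ?_)
    exact (ContinuousLinearMap.le_opNorm _ _).trans (by gcongr; exact hC _)
  have hdiv : ∀ y, diverg (fun z => - ψ z) y = ∫ x, fderiv ℝ η (x - y) (Φ x) := by
    intro y
    have h1 : ∀ i : Fin d, (fderiv ℝ (fun z => - ψ z) y (EuclideanSpace.single i 1)) i =
        ∫ x, fderiv ℝ η (x - y) (EuclideanSpace.single i 1) * Φ x i := by
      intro i
      rw [show (fun z => - ψ z) = -ψ from rfl, fderiv_neg, neg_apply,
        mol_fderiv φ Φ hΦi.locallyIntegrable]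
      have h2 := (EuclideanSpace.proj (𝕜 := ℝ) i : Euc d →L[ℝ] ℝ).integral_comp_comm
        (hint1 y (EuclideanSpace.single i 1))
      change (∫ x, (fderiv ℝ η (y - x) (EuclideanSpace.single i 1) • Φ x) i) = (∫ x, fderiv ℝ η (y - x) (EuclideanSpace.single i 1) • Φ x) i at h2
      rw [PiLp.neg_apply, ← h2, ← integral_neg]
      congr 1 with x
      rw [show x - y = -(y - x) by abel, eta_fderiv_neg]
      simp [η]
    rw [diverg]
    simp_rw [h1]
    rw [← integral_finsetSum]
    · congr 1 with x
      have hx : Φ x = ∑ i, (Φ x i) • EuclideanSpace.single i (1:ℝ) := by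
        ext j
        simp [Finset.sum_apply, Pi.single_apply]
      conv_rhs => rw [hx]
      rw [map_sum]
      congr 1 with i
      rw [map_smul, smul_eq_mul, mul_comm]
    · intro i _
      have h2 := (EuclideanSpace.proj (𝕜 := ℝ) i : Euc d →L[ℝ] ℝ).integrable_comp
        (hint1 y (EuclideanSpace.single i 1)).neg
      refine h2.congr (Eventually.of_forall fun x => ?_)
      change (-(fderiv ℝ η (y - x) (EuclideanSpace.single i 1) • Φ x)) i =
        fderiv ℝ η (x - y) (EuclideanSpace.single i 1) * Φ x i
      rw [show x - y = -(y - x) by abel, eta_fderiv_neg]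
      simp [η]
  have hprod : Integrable (Function.uncurry fun (y x : Euc d) => chi E y * fderiv ℝ η (x - y) (Φ x))
      (volume.prod volume) := by
    have h1 := (hu.mul_prod hΦi.norm).norm.const_mul C
    refine h1.mono' ?_ (Eventually.of_forall fun p => ?_)
    · apply Measurable.aestronglyMeasurable
      apply ((chi_meas hE).comp measurable_fst).mul
      have h2 : Measurable (fun p : Euc d × Euc d => (fderiv ℝ η (p.2 - p.1), Φ p.2)) := by
        apply Measurable.prodMk
        · exact (hηc.comp (continuous_snd.sub continuous_fst)).measurable
        · exact hΦm.comp measurable_snd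
      exact isBoundedBilinearMap_apply.continuous.measurable.comp h2
    · simp only [Function.uncurry, norm_mul, norm_norm]
      calc ‖chi E p.1‖ * ‖fderiv ℝ η (p.2 - p.1) (Φ p.2)‖
          ≤ ‖chi E p.1‖ * (C * ‖Φ p.2‖) := by
            gcongr
            exact (ContinuousLinearMap.le_opNorm _ _).trans (by gcongr; exact hC _)
        _ = _ := by ring
  have key : ∫ y in E, diverg (fun z => - ψ z) y = ∫ x in ball 0 R, ‖fderiv ℝ f x‖ := by
    calc ∫ y in E, diverg (fun z => - ψ z) y = ∫ y, chi E y * diverg (fun z => - ψ z) y := by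
          rw [← integral_indicator hE]
          congr 1 with y
          by_cases hy : y ∈ E <;> simp [chi, hy]
      _ = ∫ y, ∫ x, chi E y * fderiv ℝ η (x - y) (Φ x) := by
          simp_rw [hdiv, integral_const_mul]
      _ = ∫ x, ∫ y, chi E y * fderiv ℝ η (x - y) (Φ x) := integral_integral_swap hprod
      _ = ∫ x, fderiv ℝ f x (Φ x) := by
          congr 1 with x
          rw [hf, mol_fderiv φ _ hu.locallyIntegrable]
          congr 1 with y
          rw [smul_eq_mul, mul_comm]
      _ = ∫ x in ball 0 R, ‖fderiv ℝ f x‖ := by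
          simp_rw [hfΦ]
          rw [integral_indicator measurableSet_ball]
  have hlast : ∫⁻ x in ball 0 R, ‖fderiv ℝ f x‖ₑ = ENNReal.ofReal (∫ y in E, diverg (fun z => - ψ z) y) := by
    rw [key, ofReal_integral_eq_lintegral_ofReal]
    · simp
    · exact (hfc.norm.continuousOn.integrableOn_compact (isCompact_closedBall (0:Euc d) R)).mono_set
        ball_subset_closedBall
    · exact Eventually.of_forall fun x => norm_nonneg _
  rw [hlast, Per]
  exact le_iSup_of_le (fun z => - ψ z) (le_iSup_of_le hψ1.neg (le_iSup_of_le hψs.neg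
    (le_iSup_of_le (fun x => by rw [norm_neg]; exact hψn x) le_rfl)))

lemma per_upper {d : ℕ} {E : Set (Euc d)} (hE : MeasurableSet E) (hEf : volume E < ⊤)
    (φ : ContDiffBump (0 : Euc d)) :
    ∫⁻ x, ‖fderiv ℝ (mol φ (chi E)) x‖ₑ ≤ Per d E := by
  set ν := (volume : Measure (Euc d)).withDensity (fun x => ‖fderiv ℝ (mol φ (chi E)) x‖ₑ)
  have h1 : ∫⁻ x, ‖fderiv ℝ (mol φ (chi E)) x‖ₑ = ν (⋃ n : ℕ, ball 0 (n:ℝ)) := by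
    rw [iUnion_ball_nat, withDensity_apply _ MeasurableSet.univ, Measure.restrict_univ]
  have hm : Monotone (fun n : ℕ => ball (0 : Euc d) (n:ℝ)) := by
    intro a b hab; exact ball_subset_ball (by exact_mod_cast hab)
  rw [h1, hm.measure_iUnion]
  refine iSup_le fun n => ?_
  rw [withDensity_apply _ measurableSet_ball]
  exact per_ball hE hEf φ n

end

def bmp (d : ℕ) (k : ℕ) : ContDiffBump (0 : Euc d) where
  rIn := 1 / ((k:ℝ) + 1)
  rOut := 2 * (1 / ((k:ℝ) + 1))
  rIn_pos := by positivity
  rIn_lt_rOut := by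
    have : 0 < 1 / ((k:ℝ) + 1) := by positivity
    linarith

lemma mol_ae {d : ℕ} (u : Euc d → ℝ) (hu : Integrable u) :
    ∀ᵐ x, Tendsto (fun k => mol (bmp d k) u x) atTop (nhds (u x)) := by
  apply ContDiffBump.ae_convolution_tendsto_right_of_locallyIntegrable (K := 2)
  · have := (tendsto_one_div_add_atTop_nhds_zero_nat (𝕜 := ℝ)).const_mul 2
    simpa [bmp] using this
  · exact Eventually.of_forall fun k => le_rfl
  · exact hu.locallyIntegrable

lemma diverg_cont {d : ℕ} (Φ : Euc d → Euc d) (hΦ : ContDiff ℝ 1 Φ) : Continuous (diverg Φ) := by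
  have hc : Continuous (fderiv ℝ Φ) := hΦ.continuous_fderiv one_ne_zero
  unfold diverg
  fun_prop

lemma diverg_supp {d : ℕ} (Φ : Euc d → Euc d) (hs : HasCompactSupport Φ) :
    HasCompactSupport (diverg Φ) := by
  apply (hs.fderiv (𝕜 := ℝ)).mono
  intro x hx
  rw [Function.mem_support] at hx ⊢
  intro h
  apply hx
  simp [diverg, h]

lemma ibp {d : ℕ} (f : Euc d → ℝ) (hf : ContDiff ℝ 1 f) (Φ : Euc d → Euc d)
    (hΦ : ContDiff ℝ 1 Φ) (hs : HasCompactSupport Φ) :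
    ∫ x, f x * diverg Φ x = - ∫ x, fderiv ℝ f x (Φ x) := by
  have hfc : Continuous (fderiv ℝ f) := hf.continuous_fderiv one_ne_zero
  have hf0 : Continuous f := hf.continuous
  have hΦ0 : Continuous Φ := hΦ.continuous
  have hΦc : Continuous (fderiv ℝ Φ) := hΦ.continuous_fderiv one_ne_zero
  let e : Fin d → Euc d := fun i => EuclideanSpace.single i 1
  have hco : ∀ i, ContDiff ℝ 1 (fun x => Φ x i) := fun i =>
    (EuclideanSpace.proj (𝕜 := ℝ) i : Euc d →L[ℝ] ℝ).contDiff.comp hΦ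
  have hfd : ∀ i x v, fderiv ℝ (fun x => Φ x i) x v = (fderiv ℝ Φ x v) i := by
    intro i x v
    have h1 := ((EuclideanSpace.proj (𝕜 := ℝ) i : Euc d →L[ℝ] ℝ).hasFDerivAt.comp x
      (hΦ.differentiable one_ne_zero x).hasFDerivAt).fderiv
    have h2 : fderiv ℝ (fun x => Φ x i) x = _ := h1
    rw [h2]; rfl
  have hsi : ∀ i, HasCompactSupport (fun x => Φ x i) := fun i =>
    hs.mono (fun x hx => by
      rw [Function.mem_support] at hx ⊢
      intro h; apply hx; simp [h])
  have hsd : ∀ i, HasCompactSupport (fun x => (fderiv ℝ Φ x (e i)) i) := fun i =>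
    (hs.fderiv (𝕜 := ℝ)).mono (fun x hx => by
      rw [Function.mem_support] at hx ⊢
      intro h; apply hx; simp [h])
  have hi1 : ∀ i, Integrable (fun x => f x * (fderiv ℝ Φ x (e i)) i) := fun i =>
    Continuous.integrable_of_hasCompactSupport (by fun_prop) ((hsd i).mul_left)
  have hi2 : ∀ i, Integrable (fun x => fderiv ℝ f x (e i) * Φ x i) := fun i =>
    Continuous.integrable_of_hasCompactSupport (by fun_prop) ((hsi i).mul_left)
  have hi3 : ∀ i, Integrable (fun x => f x * Φ x i) := fun i =>
    Continuous.integrable_of_hasCompactSupport (by fun_prop) ((hsi i).mul_left)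
  have h1 : ∀ i, ∫ x, f x * (fderiv ℝ Φ x (e i)) i = - ∫ x, fderiv ℝ f x (e i) * Φ x i := by
    intro i
    have := integral_mul_fderiv_eq_neg_fderiv_mul_of_integrable (μ := volume) (f := f)
      (g := fun x => Φ x i) (v := e i) (hi2 i) (by simp_rw [hfd]; exact hi1 i) (hi3 i)
      (fun x _ => hf.differentiable one_ne_zero x)
      (fun x _ => (hco i).differentiable one_ne_zero x)
    simp_rw [hfd] at this
    exact this
  have h2 : ∀ x, f x * diverg Φ x = ∑ i, f x * (fderiv ℝ Φ x (e i)) i := by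
    intro x; rw [diverg, Finset.mul_sum]
  have h3 : ∀ x, fderiv ℝ f x (Φ x) = ∑ i, fderiv ℝ f x (e i) * Φ x i := by
    intro x
    have hx : Φ x = ∑ i, (Φ x i) • EuclideanSpace.single i (1:ℝ) := by
      ext j
      simp [Finset.sum_apply, Pi.single_apply]
    conv_lhs => rw [hx]
    rw [map_sum]
    congr 1 with i
    rw [map_smul, smul_eq_mul, mul_comm]
  simp_rw [h2, h3]
  rw [integral_finsetSum _ (fun i _ => hi1 i), integral_finsetSum _ (fun i _ => hi2 i),
    ← Finset.sum_neg_distrib]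
  exact Finset.sum_congr rfl fun i _ => h1 i

lemma per_lower {d : ℕ} {E : Set (Euc d)} (hE : MeasurableSet E) (hEf : volume E < ⊤) :
    Per d E ≤ liminf (fun k => ∫⁻ x, ‖fderiv ℝ (mol (bmp d k) (chi E)) x‖ₑ) atTop := by
  have hu := chi_int hE hEf
  rw [Per]
  refine iSup_le fun Φ => iSup_le fun hΦ => iSup_le fun hs => iSup_le fun hn => ?_
  have hm : ∀ k, ContDiff ℝ 1 (mol (bmp d k) (chi E)) := fun k =>
    mol_contDiff _ _ hu.locallyIntegrable
  have hdi : Integrable (diverg Φ) :=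
    (diverg_cont Φ hΦ).integrable_of_hasCompactSupport (diverg_supp Φ hs)
  have h1 : Tendsto (fun k => ∫ x, mol (bmp d k) (chi E) x * diverg Φ x) atTop
      (nhds (∫ x, chi E x * diverg Φ x)) := by
    apply tendsto_integral_of_dominated_convergence (fun x => ‖diverg Φ x‖)
    · intro k
      exact ((hm k).continuous.mul (diverg_cont Φ hΦ)).aestronglyMeasurable
    · exact hdi.norm
    · intro k
      refine Eventually.of_forall fun x => ?_
      rw [norm_mul]
      exact mul_le_of_le_one_left (norm_nonneg _) (mol_norm_le _ _ (chi_norm E) x)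
    · filter_upwards [mol_ae (chi E) hu] with x hx
      exact hx.mul_const _
  have h2 : ∫ y in E, diverg Φ y = ∫ x, chi E x * diverg Φ x := by
    rw [← integral_indicator hE]
    congr 1 with y
    by_cases hy : y ∈ E <;> simp [chi, hy]
  have h3 := (ENNReal.continuous_ofReal.tendsto _).comp h1
  rw [h2, ← h3.liminf_eq]
  refine liminf_le_liminf (Eventually.of_forall fun k => ?_)
  simp only [Function.comp]
  rw [ibp _ (hm k) Φ hΦ hs]
  refine (Real.ofReal_le_enorm _).trans ?_
  rw [enorm_neg]
  refine (enorm_integral_le_lintegral_enorm _).trans (lintegral_mono fun x => ?_)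
  refine (ContinuousLinearMap.le_opENorm _ _).trans ?_
  refine mul_le_of_le_one_right' ?_
  rw [← ofReal_norm]
  exact ENNReal.ofReal_le_one.2 (hn x)

lemma FF_liminf {d : ℕ} {E : Set (Euc d)} (hE : MeasurableSet E) (hEf : volume E < ⊤) (h : Euc d) :
    FF (chi E) h ≤ liminf (fun k => FF (mol (bmp d k) (chi E)) h) atTop := by
  have hu := chi_int hE hEf
  have hm : ∀ k, Continuous (mol (bmp d k) (chi E)) := fun k =>
    (mol_contDiff _ _ hu.locallyIntegrable).continuous
  unfold FF
  refine le_trans ?_ (lintegral_liminf_le fun k => ?_)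
  · apply lintegral_mono_ae
    have h1 := mol_ae (chi E) hu
    have h2 : ∀ᵐ x, Tendsto (fun k => mol (bmp d k) (chi E) (x + h)) atTop (nhds (chi E (x + h))) :=
      (measurePreserving_add_right volume h).quasiMeasurePreserving.ae h1
    filter_upwards [h1, h2] with x hx1 hx2
    exact ((hx2.sub hx1).enorm.liminf_eq).ge
  · have := hm k
    exact Continuous.measurable (by fun_prop)

lemma GG_upper {n : ℕ} {E : Set (Euc (n+1))} (hE : MeasurableSet E) (hEf : volume E < ⊤) (t : ℝ) :
    GG (chi E) t ≤ ‖t‖ₑ * (2 * ENNReal.ofReal (omegaB n) * Per (n+1) E) := by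
  have hu := chi_int hE hEf
  have hm : ∀ k, ContDiff ℝ 1 (mol (bmp (n+1) k) (chi E)) := fun k =>
    mol_contDiff _ _ hu.locallyIntegrable
  calc GG (chi E) t ≤ ∫⁻ θ : sphere (0 : Euc (n+1)) 1,
        liminf (fun k => FF (mol (bmp (n+1) k) (chi E)) (t • (θ : Euc (n+1)))) atTop
        ∂(volume : Measure (Euc (n+1))).toSphere := lintegral_mono fun θ => FF_liminf hE hEf _
    _ ≤ liminf (fun k => GG (mol (bmp (n+1) k) (chi E)) t) atTop := by
        refine lintegral_liminf_le fun k => ?_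
        exact (FF_meas _ (hm k).continuous.measurable).comp (by fun_prop)
    _ ≤ ‖t‖ₑ * (2 * ENNReal.ofReal (omegaB n) * Per (n+1) E) := by
        refine liminf_le_of_frequently_le' (Frequently.of_forall fun k => ?_)
        refine (GG_le _ (hm k) t).trans ?_
        gcongr
        exact per_upper hE hEf _

lemma GG_lower {n : ℕ} {E : Set (Euc (n+1))} (hE : MeasurableSet E) (hEf : volume E < ⊤)
    (L : ℝ≥0∞) (hL : L < 2 * ENNReal.ofReal (omegaB n) * Per (n+1) E) :
    ∃ δ > 0, ∀ t, 0 < t → t ≤ δ → L * ENNReal.ofReal t ≤ GG (chi E) t := by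
  have hu := chi_int hE hEf
  have hm : ∀ k, ContDiff ℝ 1 (mol (bmp (n+1) k) (chi E)) := fun k =>
    mol_contDiff _ _ hu.locallyIntegrable
  obtain ⟨k, hk⟩ : ∃ k, L < 2 * ENNReal.ofReal (omegaB n) *
      ∫⁻ x, ‖fderiv ℝ (mol (bmp (n+1) k) (chi E)) x‖ₑ := by
    by_contra! hcon
    have hc0 : (2 * ENNReal.ofReal (omegaB n)) ≠ 0 := by
      simp [omegaB_pos n]
    have hct : (2 * ENNReal.ofReal (omegaB n)) ≠ ⊤ := by finiteness
    have h1 : Per (n+1) E ≤ L / (2 * ENNReal.ofReal (omegaB n)) := by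
      refine (per_lower hE hEf).trans (liminf_le_of_frequently_le' (Frequently.of_forall fun k => ?_))
      rw [ENNReal.le_div_iff_mul_le (Or.inl hc0) (Or.inl hct), mul_comm]
      exact hcon k
    rw [ENNReal.le_div_iff_mul_le (Or.inl hc0) (Or.inl hct), mul_comm] at h1
    exact absurd hL (not_lt.2 h1)
  have h2 := eventually_lt_of_lt_liminf (hk.trans_le (GG_liminf _ (hm k)))
  rw [eventually_nhdsWithin_iff, Metric.eventually_nhds_iff] at h2
  obtain ⟨ε, hε, h⟩ := h2
  refine ⟨ε / 2, by positivity, fun t ht htd => ?_⟩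
  have h3 := h (y := t) (by rw [Real.dist_eq, sub_zero, abs_of_pos ht]; linarith) ht
  have h4 : GG (mol (bmp (n+1) k) (chi E)) t ≤ GG (chi E) t :=
    lintegral_mono fun θ => FF_mol_le _ _ hu (chi_meas hE) _
  calc L * ENNReal.ofReal t ≤ (‖t⁻¹‖ₑ * GG (mol (bmp (n+1) k) (chi E)) t) * ENNReal.ofReal t := by
        gcongr
    _ = GG (mol (bmp (n+1) k) (chi E)) t := by
        rw [Real.enorm_of_nonneg (by positivity), mul_right_comm, ← ENNReal.ofReal_mul (by positivity),
          inv_mul_cancel₀ ht.ne', ENNReal.ofReal_one, one_mul]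
    _ ≤ _ := h4

lemma GG_fin {n : ℕ} {E : Set (Euc (n+1))} (hE : MeasurableSet E) (hEf : volume E < ⊤) :
    ∃ C : ℝ≥0∞, C ≠ ⊤ ∧ ∀ t, GG (chi E) t ≤ C := by
  have hu := chi_int hE hEf
  refine ⟨2 * (∫⁻ x, ‖chi E x‖ₑ) * (volume : Measure (Euc (n+1))).toSphere univ, ?_, fun t => ?_⟩
  · have : ∫⁻ x, ‖chi E x‖ₑ ≠ ⊤ := hu.2.ne
    finiteness
  · rw [← lintegral_const, GG]
    refine lintegral_mono fun θ => ?_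
    have hmm := chi_meas hE
    calc FF (chi E) (t • (θ : Euc (n+1))) ≤
        ∫⁻ x, (‖chi E (x + t • (θ : Euc (n+1)))‖ₑ + ‖chi E x‖ₑ) :=
          lintegral_mono fun x => enorm_sub_le
      _ = _ := by
        rw [lintegral_add_left (by fun_prop),
          lintegral_add_right_eq_self (fun x => ‖chi E x‖ₑ), two_mul]

lemma ker_meas (d : ℕ) (s r : ℝ) : Measurable (_root_.ker d s r) := by
  unfold _root_.ker
  exact Measurable.ite measurableSet_Iic measurable_const (by fun_prop)

lemma J_eq {d : ℕ} {E : Set (Euc d)} (hE : MeasurableSet E) (s r : ℝ) :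
    2 * Jt d s r E = ∫⁻ h, ENNReal.ofReal (_root_.ker d s r ‖h‖) * FF (chi E) h := by
  have hk := ker_meas d s r
  have hc := chi_meas hE
  let A : Euc d → Euc d → ℝ≥0∞ := fun x y =>
    E.indicator 1 x * (Eᶜ.indicator 1 y * ENNReal.ofReal (_root_.ker d s r (dist x y)))
  have hAm : Measurable (Function.uncurry A) := by
    simp only [Function.uncurry_def, A]
    have h1 : Measurable (E.indicator (1 : Euc d → ℝ≥0∞)) := measurable_one.indicator hE
    have h2 : Measurable (Eᶜ.indicator (1 : Euc d → ℝ≥0∞)) := measurable_one.indicator hE.compl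
    fun_prop
  have hJ1 : Jt d s r E = ∫⁻ x, ∫⁻ y, A x y := by
    rw [Jt, ← lintegral_indicator hE]
    congr 1 with x
    by_cases hx : x ∈ E
    · simp only [hx, indicator_of_mem, A, Pi.one_apply, one_mul]
      rw [← lintegral_indicator hE.compl]
      congr 1 with y
      by_cases hy : y ∈ Eᶜ
      · rw [indicator_of_mem hy, indicator_of_mem hy]; simp
      · rw [indicator_of_notMem hy, indicator_of_notMem hy]; simp
    · simp [hx, A]
  have hJ2 : Jt d s r E = ∫⁻ x, ∫⁻ y, A y x := by
    rw [hJ1]; exact lintegral_lintegral_swap hAm.aemeasurable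
  have hAm' : Measurable (Function.uncurry fun x y => A y x) := hAm.comp measurable_swap
  have hsum : ∀ x y, A x y + A y x =
      ENNReal.ofReal (_root_.ker d s r (dist x y)) * ‖chi E y - chi E x‖ₑ := by
    intro x y
    by_cases hx : x ∈ E <;> by_cases hy : y ∈ E <;> simp [A, chi, hx, hy, dist_comm]
  calc 2 * Jt d s r E = (∫⁻ x, ∫⁻ y, A x y) + ∫⁻ x, ∫⁻ y, A y x := by
        rw [← hJ1, ← hJ2, two_mul]
    _ = ∫⁻ x, ∫⁻ y, (A x y + A y x) := by
        have hAi : Measurable (fun x => ∫⁻ y, A x y) := hAm.lintegral_prod_right'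
        rw [← lintegral_add_left hAi]
        congr 1 with x
        have hAx : Measurable (fun y => A x y) := hAm.comp measurable_prodMk_left
        rw [lintegral_add_left hAx]
    _ = ∫⁻ x, ∫⁻ h, ENNReal.ofReal (_root_.ker d s r ‖h‖) * ‖chi E (x + h) - chi E x‖ₑ := by
        congr 1 with x
        simp_rw [hsum]
        rw [← lintegral_add_left_eq_self _ x]
        simp
    _ = ∫⁻ h, ∫⁻ x, ENNReal.ofReal (_root_.ker d s r ‖h‖) * ‖chi E (x + h) - chi E x‖ₑ := by
        apply lintegral_lintegral_swap
        apply Measurable.aemeasurable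
        simp only [Function.uncurry_def]
        fun_prop
    _ = _ := by
        congr 1 with h
        rw [lintegral_const_mul' _ _ (by simp), FF]

lemma J_polar {n : ℕ} {E : Set (Euc (n+1))} (hE : MeasurableSet E) (s r : ℝ) :
    2 * Jt (n+1) s r E = ∫⁻ t in Ioi (0:ℝ), ENNReal.ofReal (t ^ n) *
      (ENNReal.ofReal (_root_.ker (n+1) s r t) * GG (chi E) t) := by
  have hk := ker_meas (n+1) s r
  have hF := FF_meas _ (chi_meas hE)
  rw [J_eq hE, polar (by omega) _ (by fun_prop)]
  apply setLIntegral_congr_fun measurableSet_Ioi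
  intro t ht
  simp only [Nat.add_sub_cancel]
  congr 1
  rw [GG, ← lintegral_const_mul' _ _ (by simp)]
  congr 1 with θ
  rw [norm_smul, norm_eq_of_mem_sphere, mul_one, Real.norm_of_nonneg (le_of_lt ht)]


lemma J_upper {n : ℕ} {E : Set (Euc (n+1))} (hE : MeasurableSet E) (hEf : volume E < ⊤)
    (s : ℝ) (hs : 1 ≤ s) : ∃ C : ℝ≥0∞, C ≠ ⊤ ∧ ∀ r, 0 < r → r < 1 →
    2 * Jt (n+1) s r E ≤ (2 * ENNReal.ofReal (omegaB n) * Per (n+1) E) * KK (n+1) s r 1 + C := by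
  obtain ⟨C1, hC1, h1⟩ := tail_bound (n+1) (by omega) s hs
  obtain ⟨C2, hC2, h2⟩ := GG_fin hE hEf
  refine ⟨C1 * C2, by finiteness, fun r hr hr1 => ?_⟩
  have hk := ker_meas (n+1) s r
  rw [J_polar hE, ← Ioc_union_Ioi_eq_Ioi (zero_le_one (α := ℝ)),
    lintegral_union measurableSet_Ioi (by
      rw [Set.disjoint_left]; intro x hx hx'; exact absurd hx.2 (not_le.2 hx'))]
  refine add_le_add ?_ ?_
  · rw [KK, ← lintegral_const_mul _ (by fun_prop)]
    apply setLIntegral_mono' measurableSet_Ioc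
    intro t ht
    simp only [Nat.add_sub_cancel]
    calc _ ≤ ENNReal.ofReal (t ^ n) * (ENNReal.ofReal (_root_.ker (n+1) s r t) *
          (‖t‖ₑ * (2 * ENNReal.ofReal (omegaB n) * Per (n+1) E))) := by
          gcongr; exact GG_upper hE hEf t
      _ = _ := by rw [Real.enorm_of_nonneg ht.1.le]; ring
  · calc _ ≤ ∫⁻ t in Ioi (1:ℝ), (ENNReal.ofReal (t ^ (n+1-1)) *
          ENNReal.ofReal (_root_.ker (n+1) s r t)) * C2 := by
          apply lintegral_mono
          intro t
          simp only [Nat.add_sub_cancel]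
          rw [mul_assoc]
          gcongr
          exact h2 t
      _ = (∫⁻ t in Ioi (1:ℝ), ENNReal.ofReal (t ^ (n+1-1)) *
          ENNReal.ofReal (_root_.ker (n+1) s r t)) * C2 := lintegral_mul_const _ (by fun_prop)
      _ ≤ C1 * C2 := by gcongr; exact h1 r hr hr1

lemma J_lower {n : ℕ} {E : Set (Euc (n+1))} (hE : MeasurableSet E) (hEf : volume E < ⊤)
    (s : ℝ) (L : ℝ≥0∞) (hL : L < 2 * ENNReal.ofReal (omegaB n) * Per (n+1) E) :
    ∃ δ > 0, ∀ r, L * KK (n+1) s r δ ≤ 2 * Jt (n+1) s r E := by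
  obtain ⟨δ, hδ, h⟩ := GG_lower hE hEf L hL
  refine ⟨δ, hδ, fun r => ?_⟩
  have hk := ker_meas (n+1) s r
  rw [J_polar hE, KK, ← lintegral_const_mul _ (by fun_prop)]
  refine le_trans ?_ (lintegral_mono_set (show Ioc 0 δ ⊆ Ioi 0 from fun x hx => hx.1))
  apply setLIntegral_mono' measurableSet_Ioc
  intro t ht
  simp only [Nat.add_sub_cancel]
  calc _ = ENNReal.ofReal (t ^ n) * (ENNReal.ofReal (_root_.ker (n+1) s r t) *
          (L * ENNReal.ofReal t)) := by ring
    _ ≤ _ := by gcongr; exact h t ht.1 ht.2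

lemma J_tendsto {n : ℕ} {E : Set (Euc (n+1))} (hE : MeasurableSet E) (hEf : volume E < ⊤)
    (s : ℝ) (hs : 1 ≤ s) (r : ℕ → ℝ) (hr : ∀ n, 0 < r n) (hr0 : Tendsto r atTop (nhds 0)) :
    Tendsto (fun k => 2 * Jt (n+1) s (r k) E / ENNReal.ofReal (sgm (n+1) s (r k))) atTop
      (nhds (2 * ENNReal.ofReal (omegaB n) * Per (n+1) E)) := by
  set M := 2 * ENNReal.ofReal (omegaB n) * Per (n+1) E with hM
  refine tendsto_of_le_liminf_of_limsup_le ?_ ?_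
  · refine le_of_forall_lt fun L hL => ?_
    obtain ⟨L', hL1, hL2⟩ := exists_between hL
    refine hL1.trans_le ?_
    obtain ⟨δ, hδ, h⟩ := J_lower hE hEf s L' hL2
    have h1 := ENNReal.Tendsto.const_mul (a := L')
      (KK_tendsto (n+1) (by omega) s δ hs hδ r hr hr0) (Or.inl one_ne_zero)
    rw [mul_one] at h1
    rw [← h1.liminf_eq]
    refine liminf_le_liminf (Eventually.of_forall fun k => ?_)
    rw [← mul_div_assoc]
    exact ENNReal.div_le_div_right (h (r k)) _
  · obtain ⟨C, hC, h⟩ := J_upper hE hEf s hs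
    have h1 := ENNReal.Tendsto.const_mul (a := M)
      (KK_tendsto (n+1) (by omega) s 1 hs one_pos r hr hr0) (Or.inl one_ne_zero)
    have h2 : Tendsto (fun k => C / ENNReal.ofReal (sgm (n+1) s (r k))) atTop (nhds 0) := by
      have h3 := ENNReal.tendsto_ofReal_atTop.comp (sgm_tendsto (n+1) s hs r hr hr0)
      have h4 := ENNReal.Tendsto.const_div (a := C) h3 (Or.inr hC)
      simpa using h4
    have h5 := h1.add h2
    rw [mul_one, add_zero] at h5
    rw [← h5.limsup_eq]
    refine limsup_le_limsup ?_
    filter_upwards [hr0.eventually_lt_const one_pos] with k hk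
    rw [← mul_div_assoc, ← ENNReal.add_div]
    exact ENNReal.div_le_div_right (h (r k) (hr k) hk) _

/-- **Γ-limsup inequality.** For any sequence `r_n → 0⁺` and any finite-measure
set `E` there is a recovery sequence `E_n` with `χ_{E_n} → χ_E` in `L¹(ℝ^d)` and
`J̃_{r_n}^s(E_n)/σ^s(r_n) → ω_{d-1}·Per(E)` (limit taken in `[0,+∞]`). -/
theorem stmt4 (d : ℕ) (hd : 2 ≤ d) (s : ℝ) (hs : 1 ≤ s)
    (r : ℕ → ℝ) (hrpos : ∀ n, 0 < r n) (hr0 : Tendsto r atTop (nhds 0))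
    (E : Set (Euc d)) (hEmeas : MeasurableSet E) (hEfin : volume E < ⊤) :
    ∃ En : ℕ → Set (Euc d), (∀ n, MeasurableSet (En n)) ∧ (∀ n, volume (En n) < ⊤) ∧
      Tendsto (fun n => volume ((En n) ∆ E)) atTop (nhds 0) ∧
      Tendsto (fun n => Jt d s (r n) (En n) / ENNReal.ofReal (sgm d s (r n))) atTop
        (nhds (ENNReal.ofReal (omegaB (d - 1)) * Per d E)) := by
  refine ⟨fun _ => E, fun _ => hEmeas, fun _ => hEfin, by simp, ?_⟩
  obtain ⟨n, rfl⟩ : ∃ n, d = n + 1 := ⟨d - 1, by omega⟩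
  have h := ENNReal.Tendsto.const_mul (a := 2⁻¹) (J_tendsto hEmeas hEfin s hs r hrpos hr0)
    (Or.inr (by simp))
  have h2 : (2⁻¹ : ℝ≥0∞) * 2 = 1 := ENNReal.inv_mul_cancel (by simp) (by simp)
  simp only [Nat.add_sub_cancel]
  convert h using 2
  · rw [mul_div_assoc, ← mul_assoc, h2, one_mul]
  · rw [mul_assoc, ← mul_assoc, h2, one_mul]

end
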